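/- arXiv:2309.04610 — 6 statements merged into one kernel-verified Lean document; each statement's English description precedes it below -/
import Mathlib

section
/- For a fixed t ∈ ℝ, one has t < 0 if and only if every nonzero element of ℍ_t has a two-sided inverse for the multiplication ·_t; that is, t < 0 exactly when ℍ_t is a (noncommutative) division ring. -/
/-- The `t`-scaled hypercomplex multiplication on `ℂ × ℂ`. -/
noncomputable def hmul (t : ℝ) (h₁ h₂ : ℂ × ℂ) : ℂ × ℂ :=
  (h₁.1 * h₂.1 + (t : ℂ) * h₁.2 * (starRingEnd ℂ) h₂.2,
   h₁.1 * h₂.2 + h₁.2 * (starRingEnd ℂ) h₂.1)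

/-- For `t < 0` the form `|a|² - t|b|²` is nonzero away from the origin. -/
theorem normSq_sub_mul_normSq_ne_zero {t : ℝ} (ht : t < 0) {h : ℂ × ℂ} (hh : h ≠ 0) :
    Complex.normSq h.1 - t * Complex.normSq h.2 ≠ 0 := by
  intro h0
  have h₁ := Complex.normSq_nonneg h.1
  have h₂ := Complex.normSq_nonneg h.2
  have hb : Complex.normSq h.2 = 0 := by nlinarith
  have ha : Complex.normSq h.1 = 0 := by simpa [hb] using h0
  exact hh (Prod.ext (Complex.normSq_eq_zero.1 ha) (Complex.normSq_eq_zero.1 hb))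

/-- If `n = |a|² - t|b|²` is nonzero, then `(conj a / n, -b / n)` is a two-sided inverse
of `(a, b)`. -/
theorem exists_hmul_inverse {t : ℝ} {h : ℂ × ℂ}
    (hn : Complex.normSq h.1 - t * Complex.normSq h.2 ≠ 0) :
    ∃ h' : ℂ × ℂ, hmul t h h' = ((1 : ℂ), (0 : ℂ)) ∧ hmul t h' h = ((1 : ℂ), (0 : ℂ)) := by
  obtain ⟨a, b⟩ := h
  generalize hN : Complex.normSq a - t * Complex.normSq b = n at hn
  have hn' : (n : ℂ) ≠ 0 := Complex.ofReal_ne_zero.2 hn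
  have key : a * starRingEnd ℂ a - t * (b * starRingEnd ℂ b) = n := by
    rw [Complex.mul_conj, Complex.mul_conj, ← hN]
    push_cast
    rfl
  refine ⟨(starRingEnd ℂ a / n, -b / n), Prod.ext ?_ ?_, Prod.ext ?_ ?_⟩ <;>
    simp only [hmul, map_div₀, map_neg, Complex.conj_conj, Complex.conj_ofReal] <;>
    field_simp
  · linear_combination key
  · ring
  · linear_combination key
  · ring

/-- For `t ≥ 0` the element `(√t, 1)` has no right inverse. -/
theorem hmul_sqrt_one_ne_one {t : ℝ} (ht : 0 ≤ t) (h : ℂ × ℂ) :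
    hmul t ((√t : ℝ), 1) h ≠ ((1 : ℂ), (0 : ℂ)) := by
  intro hr
  obtain ⟨c, d⟩ := h
  have hs : ((√t : ℝ) : ℂ) * (√t : ℝ) = t := by
    rw [← Complex.ofReal_mul, Real.mul_self_sqrt ht]
  have h₁ := congrArg Prod.fst hr
  have h₂ := congrArg (fun p => starRingEnd ℂ p.2) hr
  simp only [hmul, map_add, map_mul, map_one, map_zero, Complex.conj_conj,
    Complex.conj_ofReal] at h₁ h₂
  exact one_ne_zero (α := ℂ)
    (by linear_combination (√t : ℝ) * h₂ - h₁ - starRingEnd ℂ d * hs)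

/-- `t < 0` iff every nonzero element of `ℍ_t` has a two-sided inverse for `·_t`,
i.e. `ℍ_t` is a (noncommutative) division ring exactly when `t < 0`. -/
theorem neg_scale_iff_division_ring (t : ℝ) :
    t < 0 ↔ ∀ h : ℂ × ℂ, h ≠ 0 →
      ∃ h' : ℂ × ℂ, hmul t h h' = ((1 : ℂ), (0 : ℂ)) ∧
        hmul t h' h = ((1 : ℂ), (0 : ℂ)) := by
  refine ⟨fun ht h hh => exists_hmul_inverse (normSq_sub_mul_normSq_ne_zero ht hh), fun H => ?_⟩
  by_contra! ht
  obtain ⟨h', hr, -⟩ := H ((√t : ℝ), 1) fun h0 => one_ne_zero (congrArg Prod.snd h0)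
  exact hmul_sqrt_one_ne_one ht h' hr
end

section
/- If t < 0, then the form ⟨·,·⟩_t is a (definite) inner product on ℍ_t over ℝ: it is symmetric, additive in each argument, satisfies ⟨r·h₁, h₂⟩_t = r·⟨h₁,h₂⟩_t for r ∈ ℝ (where r·(a,b) = (r·a, r·b)), and ⟨h,h⟩_t ≥ 0 for all h ∈ ℍ_t, with ⟨h,h⟩_t = 0 if and only if h = (0,0). -/
/-- The hypercomplex conjugate `(a,b)† = (conj a, −b)`. -/
noncomputable def hconj (h : ℂ × ℂ) : ℂ × ℂ := ((starRingEnd ℂ) h.1, -h.2)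

/-- The ℝ-valued form `⟨h₁,h₂⟩_t = Re((h₁ ·_t h₂†).1)`. -/
noncomputable def hform (t : ℝ) (h₁ h₂ : ℂ × ℂ) : ℝ := (hmul t h₁ (hconj h₂)).1.re

theorem hform_eq (t : ℝ) (h₁ h₂ : ℂ × ℂ) :
    hform t h₁ h₂ = h₁.1.re * h₂.1.re + h₁.1.im * h₂.1.im
      - t * (h₁.2.re * h₂.2.re + h₁.2.im * h₂.2.im) := by
  simp [hform, hmul, hconj]
  ring

theorem hform_self (t : ℝ) (h : ℂ × ℂ) :
    hform t h h = Complex.normSq h.1 - t * Complex.normSq h.2 := by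
  simp only [hform_eq, Complex.normSq_apply]

/-- For `t < 0`, the form `⟨·,·⟩_t` is a definite inner product on `ℍ_t`
over ℝ: symmetric, additive in each argument, ℝ-homogeneous
(`r·(a,b) = (r·a, r·b)` is the scalar action), nonnegative on the diagonal,
and `⟨h,h⟩_t = 0` iff `h = (0,0)`. -/
theorem hform_inner_product_of_neg (t : ℝ) (ht : t < 0) :
    (∀ h₁ h₂ : ℂ × ℂ, hform t h₁ h₂ = hform t h₂ h₁) ∧
    (∀ h₁ h₂ h₃ : ℂ × ℂ, hform t (h₁ + h₂) h₃ = hform t h₁ h₃ + hform t h₂ h₃) ∧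
    (∀ h₁ h₂ h₃ : ℂ × ℂ, hform t h₁ (h₂ + h₃) = hform t h₁ h₂ + hform t h₁ h₃) ∧
    (∀ r : ℝ, ∀ h₁ h₂ : ℂ × ℂ, hform t (r • h₁) h₂ = r * hform t h₁ h₂) ∧
    (∀ h : ℂ × ℂ, 0 ≤ hform t h h) ∧
    (∀ h : ℂ × ℂ, hform t h h = 0 ↔ h = 0) := by
  refine ⟨fun h₁ h₂ => ?_, fun h₁ h₂ h₃ => ?_, fun h₁ h₂ h₃ => ?_, fun r h₁ h₂ => ?_,
    fun h => ?_, fun h => ⟨fun h0 => ?_, ?_⟩⟩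
  · simp only [hform_eq]
    ring
  · simp only [hform_eq, Prod.fst_add, Prod.snd_add, Complex.add_re, Complex.add_im]
    ring
  · simp only [hform_eq, Prod.fst_add, Prod.snd_add, Complex.add_re, Complex.add_im]
    ring
  · simp only [hform_eq, Prod.smul_fst, Prod.smul_snd, Complex.smul_re, Complex.smul_im,
      smul_eq_mul]
    ring
  · rw [hform_self]
    have := mul_nonpos_of_nonpos_of_nonneg ht.le (Complex.normSq_nonneg h.2)
    linarith [Complex.normSq_nonneg h.1]
  · rw [hform_self] at h0
    have hb := mul_nonpos_of_nonpos_of_nonneg ht.le (Complex.normSq_nonneg h.2)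
    have ha := Complex.normSq_nonneg h.1
    have ha0 : Complex.normSq h.1 = 0 := by linarith
    have hb0 : t * Complex.normSq h.2 = 0 := by linarith
    exact Prod.ext (Complex.normSq_eq_zero.mp ha0)
      (Complex.normSq_eq_zero.mp ((mul_eq_zero.mp hb0).resolve_left ht.ne))
  · rintro rfl
    simp [hform_self]
end

section
/- Fix t ∈ ℝ with t ≠ 0, and let f : ℝ⁴ → ℍ_t be twice continuously differentiable. Then ∇_t†(∇_t f) = ∂₁²f + ∂₂²f − sgn(t)·∂₃²f − sgn(t)·∂₄²f; that is, the composition ∇_t†∇_t equals the t-scaled Laplacian Δ_t. -/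
/-- The element `1 = (1,0)` of `ℍ_t`. -/
noncomputable def oneH : ℂ × ℂ := (1, 0)

/-- The element `i = (i_ℂ, 0)` of `ℍ_t`. -/
noncomputable def iH : ℂ × ℂ := (Complex.I, 0)

/-- The element `j_t = (0,1)` of `ℍ_t`. -/
noncomputable def jH : ℂ × ℂ := (0, 1)

/-- The element `k_t = (0, i_ℂ)` of `ℍ_t`. -/
noncomputable def kH : ℂ × ℂ := (0, Complex.I)

/-- The partial derivative of `f : ℝ⁴ → ℍ_t` in the `l`-th coordinate
direction. -/
noncomputable def pd (l : Fin 4) (f : (Fin 4 → ℝ) → ℂ × ℂ) :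
    (Fin 4 → ℝ) → ℂ × ℂ :=
  fun x => fderiv ℝ f x (Pi.single l 1)

/-- The operator `∇_t f = ∂₁f + i·∂₂f − (s/ρ)·j_t·∂₃f − (s/ρ)·k_t·∂₄f`,
with `s = sgn t`, `ρ = √|t|`, constants multiplying from the left in `ℍ_t`. -/
noncomputable def nablaL (t : ℝ) (f : (Fin 4 → ℝ) → ℂ × ℂ) :
    (Fin 4 → ℝ) → ℂ × ℂ :=
  fun x => pd 0 f x + hmul t iH (pd 1 f x)
    - (Real.sign t / Real.sqrt |t|) • hmul t jH (pd 2 f x)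
    - (Real.sign t / Real.sqrt |t|) • hmul t kH (pd 3 f x)

/-- The operator `∇_t† f = ∂₁f − i·∂₂f + (s/ρ)·j_t·∂₃f + (s/ρ)·k_t·∂₄f`. -/
noncomputable def nablaD (t : ℝ) (f : (Fin 4 → ℝ) → ℂ × ℂ) :
    (Fin 4 → ℝ) → ℂ × ℂ :=
  fun x => pd 0 f x - hmul t iH (pd 1 f x)
    + (Real.sign t / Real.sqrt |t|) • hmul t jH (pd 2 f x)
    + (Real.sign t / Real.sqrt |t|) • hmul t kH (pd 3 f x)

/-- The right-hand operator
`f∇_t = ∂₁f + ∂₂f·i − (s/ρ)·∂₃f·j_t − (s/ρ)·∂₄f·k_t`,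
with constants multiplying from the right in `ℍ_t`. -/
noncomputable def nablaR (t : ℝ) (f : (Fin 4 → ℝ) → ℂ × ℂ) :
    (Fin 4 → ℝ) → ℂ × ℂ :=
  fun x => pd 0 f x + hmul t (pd 1 f x) iH
    - (Real.sign t / Real.sqrt |t|) • hmul t (pd 2 f x) jH
    - (Real.sign t / Real.sqrt |t|) • hmul t (pd 3 f x) kH

/-- The `t`-scaled Laplacian `Δ_t f = ∂₁²f + ∂₂²f − sgn(t)·∂₃²f − sgn(t)·∂₄²f`. -/
noncomputable def lapT (t : ℝ) (f : (Fin 4 → ℝ) → ℂ × ℂ) :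
    (Fin 4 → ℝ) → ℂ × ℂ :=
  fun x => pd 0 (pd 0 f) x + pd 1 (pd 1 f) x
    - Real.sign t • pd 2 (pd 2 f) x - Real.sign t • pd 3 (pd 3 f) x

/-- Left multiplication in `ℍ_t` as a real continuous linear map. -/
noncomputable def hmulLeft (t : ℝ) (c : ℂ × ℂ) : ℂ × ℂ →L[ℝ] ℂ × ℂ :=
  LinearMap.toContinuousLinearMap
    { toFun := hmul t c
      map_add' := fun a b => by
        ext1 <;> simp only [hmul, Prod.fst_add, Prod.snd_add, map_add] <;> ring
      map_smul' := fun r a => by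
        ext1 <;> simp only [hmul, Prod.smul_fst, Prod.smul_snd, Complex.real_smul, map_mul,
          Complex.conj_ofReal, RingHom.id_apply] <;> ring }

theorem differentiable_pd {f : (Fin 4 → ℝ) → ℂ × ℂ} (hf : ContDiff ℝ 2 f) (l : Fin 4) :
    Differentiable ℝ (pd l f) :=
  ((hf.fderiv_right (m := 1) (by norm_num)).differentiable (by norm_num)).clm_apply
    (differentiable_const _)

theorem pd_comm {f : (Fin 4 → ℝ) → ℂ × ℂ} (hf : ContDiff ℝ 2 f) (l m : Fin 4)
    (x : Fin 4 → ℝ) : pd l (pd m f) x = pd m (pd l f) x := by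
  have hd : DifferentiableAt ℝ (fderiv ℝ f) x :=
    (hf.fderiv_right (m := 1) (by norm_num)).differentiable (by norm_num) x
  have pd_pd (l m : Fin 4) :
      pd l (pd m f) x = fderiv ℝ (fderiv ℝ f) x (Pi.single l 1) (Pi.single m 1) := by
    unfold pd
    rw [fderiv_clm_apply hd (differentiableAt_const _)]
    simp
  rw [pd_pd, pd_pd]
  exact (hf.contDiffAt.isSymmSndFDerivAt (by simp)) _ _

theorem pd_nablaL (t : ℝ) {f : (Fin 4 → ℝ) → ℂ × ℂ} (hf : ContDiff ℝ 2 f) (l : Fin 4)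
    (x : Fin 4 → ℝ) :
    pd l (nablaL t f) x = pd l (pd 0 f) x + hmul t iH (pd l (pd 1 f) x)
      - (Real.sign t / Real.sqrt |t|) • hmul t jH (pd l (pd 2 f) x)
      - (Real.sign t / Real.sqrt |t|) • hmul t kH (pd l (pd 3 f) x) := by
  have hd (m : Fin 4) : HasFDerivAt (pd m f) (fderiv ℝ (pd m f) x) x :=
    (differentiable_pd hf m x).hasFDerivAt
  have hc (c : ℂ × ℂ) (m : Fin 4) := (hmulLeft t c).hasFDerivAt.comp x (hd m)
  have h : HasFDerivAt (nablaL t f) _ x :=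
    (((hd 0).add (hc iH 1)).sub ((hc jH 2).const_smul (Real.sign t / Real.sqrt |t|))).sub
      ((hc kH 3).const_smul (Real.sign t / Real.sqrt |t|))
  rw [pd, h.fderiv]
  rfl

theorem sign_div_sqrt_abs_sq_mul {t : ℝ} (ht : t ≠ 0) :
    (Real.sign t / Real.sqrt |t|) ^ 2 * t = Real.sign t := by
  rw [div_pow, Real.sq_sqrt (abs_nonneg t)]
  rcases ht.lt_or_gt with h | h
  · rw [Real.sign_of_neg h, abs_of_neg h]
    field_simp
  · rw [Real.sign_of_pos h, abs_of_pos h]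
    field_simp

/-- For `t ≠ 0` and `f : ℝ⁴ → ℍ_t` twice continuously differentiable,
`∇_t†(∇_t f) = Δ_t f`. -/
theorem nablaD_nablaL_eq_lap (t : ℝ) (ht : t ≠ 0)
    (f : (Fin 4 → ℝ) → ℂ × ℂ) (hf : ContDiff ℝ 2 f) :
    ∀ x, nablaD t (nablaL t f) x = lapT t f x := by
  intro x
  have hs : ((Real.sign t / Real.sqrt |t| : ℝ) : ℂ) ^ 2 * t = (Real.sign t : ℝ) := by
    exact_mod_cast sign_div_sqrt_abs_sq_mul ht
  have hI := Complex.I_sq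
  simp only [nablaD, lapT, pd_nablaL t hf]
  rw [pd_comm hf 1 0, pd_comm hf 2 0, pd_comm hf 3 0, pd_comm hf 2 1, pd_comm hf 3 1,
    pd_comm hf 3 2]
  generalize Real.sign t / Real.sqrt |t| = c at hs ⊢
  ext1 <;>
  simp only [hmul, iH, jH, kH, Prod.fst_add, Prod.snd_add, Prod.fst_sub, Prod.snd_sub,
    Prod.smul_fst, Prod.smul_snd, Complex.real_smul, map_add, map_sub, map_mul, map_zero, map_one,
    Complex.conj_ofReal, Complex.conj_I, Complex.conj_conj, ← hs] <;>
  grind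
end

section
/- Fix t ∈ ℝ with t ≠ 0 and set s = sgn(t), ρ = √|t|. The functions η₂, η₃, η₄ : ℝ⁴ → ℍ_t given by η₂(x) = x₂·1 − x₁·i, η₃(x) = x₃·1 + (s·x₁/ρ)·j_t, η₄(x) = x₄·1 + (s·x₁/ρ)·k_t (for x = (x₁,x₂,x₃,x₄)) are t-regular and t-harmonic on all of ℝ⁴: for each l ∈ {2,3,4}, ∇_t η_l = 0, η_l ∇_t = 0, and Δ_t η_l = 0. -/
/-- `η₂(x) = x₂·1 − x₁·i`. -/
noncomputable def eta2 : (Fin 4 → ℝ) → ℂ × ℂ :=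
  fun x => x 1 • oneH - x 0 • iH

/-- `η₃(x) = x₃·1 + (sgn(t)·x₁/√|t|)·j_t`. -/
noncomputable def eta3 (t : ℝ) : (Fin 4 → ℝ) → ℂ × ℂ :=
  fun x => x 2 • oneH + (Real.sign t * x 0 / Real.sqrt |t|) • jH

/-- `η₄(x) = x₄·1 + (sgn(t)·x₁/√|t|)·k_t`. -/
noncomputable def eta4 (t : ℝ) : (Fin 4 → ℝ) → ℂ × ℂ :=
  fun x => x 3 • oneH + (Real.sign t * x 0 / Real.sqrt |t|) • kH

theorem pd_const (l : Fin 4) (c : ℂ × ℂ) : pd l (fun _ => c) = 0 := by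
  funext x
  simp [pd]

theorem pd_smul_add_smul (l a b : Fin 4) (u v : ℂ × ℂ) :
    pd l (fun x => x a • u + x b • v) =
      fun _ => (Pi.single l 1 : Fin 4 → ℝ) a • u + (Pi.single l 1 : Fin 4 → ℝ) b • v := by
  funext x
  have h (c : Fin 4) (w : ℂ × ℂ) : HasFDerivAt (fun x : Fin 4 → ℝ => x c • w)
      ((ContinuousLinearMap.proj (R := ℝ) (φ := fun _ : Fin 4 => ℝ) c).smulRight w) x :=
    ((ContinuousLinearMap.proj (R := ℝ) (φ := fun _ : Fin 4 => ℝ) c).smulRight w).hasFDerivAt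
  rw [pd, ((h a u).fun_add (h b v)).fderiv]
  simp

theorem lapT_smul_add_smul (t : ℝ) (a b : Fin 4) (u v : ℂ × ℂ) (x : Fin 4 → ℝ) :
    lapT t (fun x => x a • u + x b • v) x = 0 := by
  simp only [lapT, pd_smul_add_smul, pd_const]
  simp

theorem eta2_eq : eta2 = fun x => x 1 • oneH + x 0 • (-iH) := by
  funext x
  simp [eta2, sub_eq_add_neg]

theorem eta3_eq (t : ℝ) :
    eta3 t = fun x => x 2 • oneH + x 0 • ((Real.sign t / Real.sqrt |t|) • jH) := by
  funext x
  rw [eta3, smul_smul, mul_div_right_comm, mul_comm]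

theorem eta4_eq (t : ℝ) :
    eta4 t = fun x => x 3 • oneH + x 0 • ((Real.sign t / Real.sqrt |t|) • kH) := by
  funext x
  rw [eta4, smul_smul, mul_div_right_comm, mul_comm]

/-- For `t ≠ 0`, the functions `η₂, η₃, η₄` are `t`-regular (both left and
right) and `t`-harmonic on all of `ℝ⁴`. -/
theorem eta_t_regular_t_harmonic (t : ℝ) (ht : t ≠ 0) :
    ((∀ x, nablaL t eta2 x = 0) ∧ (∀ x, nablaR t eta2 x = 0) ∧
      (∀ x, lapT t eta2 x = 0)) ∧
    ((∀ x, nablaL t (eta3 t) x = 0) ∧ (∀ x, nablaR t (eta3 t) x = 0) ∧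
      (∀ x, lapT t (eta3 t) x = 0)) ∧
    ((∀ x, nablaL t (eta4 t) x = 0) ∧ (∀ x, nablaR t (eta4 t) x = 0) ∧
      (∀ x, lapT t (eta4 t) x = 0)) := by
  rw [eta2_eq, eta3_eq, eta4_eq]
  refine ⟨⟨fun x => ?_, fun x => ?_, lapT_smul_add_smul t _ _ _ _⟩,
    ⟨fun x => ?_, fun x => ?_, lapT_smul_add_smul t _ _ _ _⟩,
    ⟨fun x => ?_, fun x => ?_, lapT_smul_add_smul t _ _ _ _⟩⟩ <;>
  (simp only [nablaL, nablaR, pd_smul_add_smul]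
   simp [hmul, oneH, iH, jH, kH])
end

section
/- Fix t ∈ ℝ with t ≠ 0 and set s = sgn(t), ρ = √|t|. For 𝐧 = (n₁,n₂,n₃) ∈ ℕ³ with N = n₁ + n₂ + n₃ ≥ 1, let g : Fin N → (ℝ⁴ → ℍ_t) assign η₂ to the first n₁ indices, η₃ to the next n₂ indices, and η₄ to the last n₃ indices, and define the symmetrized product η^𝐧(w) = (1/N!) · Σ_{σ ∈ Perm(Fin N)} g(σ(0))(w) ·_t g(σ(1))(w) ·_t ⋯ ·_t g(σ(N−1))(w). Then η^𝐧 is t-regular and t-harmonic on ℝ⁴: ∇_t η^𝐧 = 0, η^𝐧 ∇_t = 0, and Δ_t η^𝐧 = 0. -/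
/-- The ordered product `h₁ ·_t h₂ ·_t ⋯ ·_t h_N` of a list of hypercomplex
numbers. -/
noncomputable def hprod (t : ℝ) (l : List (ℂ × ℂ)) : ℂ × ℂ :=
  l.foldr (hmul t) oneH

/-- The symmetrized product
`η^𝐧(w) = (1/N!) Σ_{σ ∈ S_N} g(σ 0)(w) ·_t ⋯ ·_t g(σ (N−1))(w)`. -/
noncomputable def symProd (t : ℝ) (N : ℕ) (g : Fin N → (Fin 4 → ℝ) → ℂ × ℂ) :
    (Fin 4 → ℝ) → ℂ × ℂ :=
  fun w => ((N.factorial : ℝ))⁻¹ •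
    ∑ σ : Equiv.Perm (Fin N), hprod t (List.ofFn fun i => g (σ i) w)

/-- **Polarization identity**: the symmetrization of a multilinear map is an alternating sum of its
values on the diagonal. -/
theorem MultilinearMap.sum_perm_eq_sum_diagonal {R ι M M' : Type*} [CommRing R] [Fintype ι]
    [DecidableEq ι] [AddCommGroup M] [Module R M] [AddCommGroup M'] [Module R M']
    (f : MultilinearMap R (fun _ : ι => M) M') (c : ι → M) :
    ∑ σ : Equiv.Perm ι, f (fun i => c (σ i)) =
      ∑ T : Finset ι, (-1 : ℤ) ^ T.card • f (fun _ => ∑ i ∈ Tᶜ, c i) := by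
  have expand : ∀ T : Finset ι, f (fun _ => ∑ i ∈ Tᶜ, c i) =
      ∑ p : ι → ι, if T ⊆ (Finset.univ.image p)ᶜ then f (fun i => c (p i)) else 0 := by
    intro T
    rw [f.map_sum_finset (fun _ j => c j) (fun _ => Tᶜ), ← Finset.sum_filter]
    refine Finset.sum_congr ?_ fun _ _ => rfl
    ext p
    simp only [Fintype.mem_piFinset, Finset.mem_compl, Finset.mem_filter, Finset.mem_univ,
      true_and, Finset.subset_iff, Finset.mem_image, not_exists]
    exact ⟨fun h x hx i hi => h i (hi ▸ hx), fun h i hi => h hi i rfl⟩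
  have alternating : ∀ p : ι → ι,
      (∑ T : Finset ι, (-1 : ℤ) ^ T.card •
        if T ⊆ (Finset.univ.image p)ᶜ then f (fun i => c (p i)) else 0) =
      if Function.Bijective p then f (fun i => c (p i)) else 0 := by
    intro p
    have key : (∑ T : Finset ι, if T ⊆ (Finset.univ.image p)ᶜ then (-1 : ℤ) ^ T.card else 0) =
        if Function.Bijective p then 1 else 0 := by
      have hfilter : Finset.univ.filter (fun T => T ⊆ (Finset.univ.image p)ᶜ) =
          ((Finset.univ.image p)ᶜ).powerset := by ext; simp
      rw [← Finset.sum_filter, hfilter, Finset.sum_powerset_neg_one_pow_card]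
      refine if_congr ?_ rfl rfl
      rw [Finset.compl_eq_empty_iff, ← Finite.surjective_iff_bijective]
      simp [Finset.eq_univ_iff_forall, Function.Surjective]
    calc _ = (∑ T : Finset ι, if T ⊆ (Finset.univ.image p)ᶜ then (-1 : ℤ) ^ T.card else 0) •
          f (fun i => c (p i)) := by
          rw [Finset.sum_smul]
          refine Finset.sum_congr rfl fun T _ => ?_
          split_ifs <;> simp
      _ = _ := by rw [key]; split_ifs <;> simp
  simp only [expand, Finset.smul_sum]
  rw [Finset.sum_comm]
  simp only [alternating]
  rw [← Finset.sum_filter]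
  exact (Finset.sum_bij (fun p h => Equiv.ofBijective p (Finset.mem_filter.1 h).2)
    (fun _ _ => Finset.mem_univ _) (fun _ _ _ _ h => by injection h)
    (fun b _ => ⟨b, Finset.mem_filter.2 ⟨Finset.mem_univ _, b.bijective⟩,
      Equiv.coe_fn_injective rfl⟩) fun _ _ => rfl).symm

theorem hmul_assoc (t : ℝ) (a b c : ℂ × ℂ) : hmul t (hmul t a b) c = hmul t a (hmul t b c) := by
  ext1 <;> simp [hmul] <;> ring

theorem hmul_add (t : ℝ) (a b c : ℂ × ℂ) : hmul t a (b + c) = hmul t a b + hmul t a c := by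
  ext1 <;> simp [hmul] <;> ring

theorem add_hmul (t : ℝ) (a b c : ℂ × ℂ) : hmul t (a + b) c = hmul t a c + hmul t b c := by
  ext1 <;> simp [hmul] <;> ring

theorem smul_hmul (t r : ℝ) (a b : ℂ × ℂ) : hmul t (r • a) b = r • hmul t a b := by
  ext1 <;> simp [hmul] <;> ring

theorem hmul_smul (t r : ℝ) (a b : ℂ × ℂ) : hmul t a (r • b) = r • hmul t a b := by
  ext1 <;> simp [hmul] <;> ring

/-- The normed space `ℂ × ℂ`, to be equipped with the multiplication `hmul t`. -/
def Hypercomplex (_ : ℝ) : Type := ℂ × ℂ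

namespace Hypercomplex

variable {t : ℝ}

noncomputable instance : NormedAddCommGroup (Hypercomplex t) :=
  inferInstanceAs (NormedAddCommGroup (ℂ × ℂ))

noncomputable instance : NormedSpace ℝ (Hypercomplex t) :=
  inferInstanceAs (NormedSpace ℝ (ℂ × ℂ))

instance : FiniteDimensional ℝ (Hypercomplex t) :=
  inferInstanceAs (FiniteDimensional ℝ (ℂ × ℂ))

noncomputable instance : Ring (Hypercomplex t) :=
  { (inferInstance : AddCommGroup (Hypercomplex t)) with
    mul := hmul t
    one := oneH
    mul_assoc := hmul_assoc t
    one_mul := fun a => show hmul t oneH a = a from Prod.ext (by simp [hmul, oneH])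
      (by simp [hmul, oneH])
    mul_one := fun a => show hmul t a oneH = a from Prod.ext (by simp [hmul, oneH])
      (by simp [hmul, oneH])
    left_distrib := hmul_add t
    right_distrib := add_hmul t
    zero_mul := fun a => show hmul t (0 : ℂ × ℂ) a = (0 : ℂ × ℂ) from
      Prod.ext (by simp [hmul]) (by simp [hmul])
    mul_zero := fun a => show hmul t a (0 : ℂ × ℂ) = (0 : ℂ × ℂ) from
      Prod.ext (by simp [hmul]) (by simp [hmul]) }

noncomputable instance : Algebra ℝ (Hypercomplex t) :=
  Algebra.ofModule (smul_hmul t) (hmul_smul t)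

variable (t)

/-- The element `i` of the ring. -/
noncomputable def I : Hypercomplex t := iH

/-- The element `j` of the ring. -/
noncomputable def J : Hypercomplex t := jH

/-- The element `k` of the ring. -/
noncomputable def K : Hypercomplex t := kH

theorem I_mul_I : I t * I t = -1 :=
  show hmul t iH iH = -oneH from Prod.ext (by simp [hmul, iH, oneH]) (by simp [hmul, iH, oneH])

theorem I_mul_J : I t * J t = K t :=
  show hmul t iH jH = kH from Prod.ext (by simp [hmul, iH, jH, kH]) (by simp [hmul, iH, jH, kH])

theorem J_mul_I : J t * I t = -K t :=
  show hmul t jH iH = -kH from Prod.ext (by simp [hmul, iH, jH, kH]) (by simp [hmul, iH, jH, kH])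

theorem I_mul_K : I t * K t = -J t :=
  show hmul t iH kH = -jH from Prod.ext (by simp [hmul, iH, jH, kH]) (by simp [hmul, iH, jH, kH])

theorem K_mul_I : K t * I t = J t :=
  show hmul t kH iH = jH from Prod.ext (by simp [hmul, iH, jH, kH]) (by simp [hmul, iH, jH, kH])

theorem J_mul_J : J t * J t = t • (1 : Hypercomplex t) :=
  show hmul t jH jH = t • oneH from
    Prod.ext (by simp [hmul, jH, oneH]) (by simp [hmul, jH, oneH])

theorem K_mul_K : K t * K t = t • (1 : Hypercomplex t) :=
  show hmul t kH kH = t • oneH from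
    Prod.ext (by simp [hmul, kH, oneH, mul_assoc]) (by simp [hmul, kH, oneH])

theorem J_mul_K : J t * K t = -(t • I t) :=
  show hmul t jH kH = -(t • iH) from
    Prod.ext (by simp [hmul, jH, kH, iH]) (by simp [hmul, jH, kH, iH])

theorem K_mul_J : K t * J t = t • I t :=
  show hmul t kH jH = t • iH from
    Prod.ext (by simp [hmul, jH, kH, iH]) (by simp [hmul, jH, kH, iH])

variable {t}

/-- The multiplication as a continuous bilinear map. -/
noncomputable def mulCLM : Hypercomplex t →L[ℝ] Hypercomplex t →L[ℝ] Hypercomplex t :=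
  LinearMap.toContinuousLinearMap
    (LinearMap.toContinuousLinearMap.toLinearMap ∘ₗ LinearMap.mul ℝ (Hypercomplex t))

theorem mulCLM_apply (a b : Hypercomplex t) : mulCLM a b = a * b := rfl

theorem hasFDerivAt_pow {E : Type*} [NormedAddCommGroup E] [NormedSpace ℝ E]
    (L : E →L[ℝ] Hypercomplex t) (hL : ∀ x y, Commute (L x) (L y)) (n : ℕ) (x : E) :
    HasFDerivAt (fun y => L y ^ n) ((n : ℝ) • (mulCLM.flip (L x ^ (n - 1))).comp L) x := by
  induction n with
  | zero => simpa using hasFDerivAt_const (1 : Hypercomplex t) x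
  | succ n ih =>
    have h := mulCLM.hasFDerivAt_of_bilinear ih L.hasFDerivAt
    simp only [mulCLM_apply, ← pow_succ] at h
    refine h.congr_fderiv ?_
    ext1 v
    have hc : L x ^ n * L v = L v * L x ^ n := ((hL x v).pow_left n)
    cases n with
    | zero => simp [mulCLM_apply]
    | succ n =>
      simp [mulCLM_apply, hc, mul_assoc, ← pow_succ, add_smul, add_comm]

variable (t)

/-- The real combination `a η₂ + b η₃ + c η₄`, as a continuous linear map. -/
noncomputable def etaComb (a b c : ℝ) : (Fin 4 → ℝ) →L[ℝ] Hypercomplex t :=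
  LinearMap.toContinuousLinearMap
    ((LinearMap.proj (R := ℝ) (φ := fun _ : Fin 4 => ℝ) 0).smulRight
        ((Real.sign t / √|t|) • (b • J t + c • K t) - a • I t) +
      (a • LinearMap.proj (R := ℝ) (φ := fun _ : Fin 4 => ℝ) 1 + b • LinearMap.proj 2 +
        c • LinearMap.proj 3).smulRight 1)

theorem etaComb_apply (a b c : ℝ) (x : Fin 4 → ℝ) :
    etaComb t a b c x = x 0 • ((Real.sign t / √|t|) • (b • J t + c • K t) - a • I t) +
      (a * x 1 + b * x 2 + c * x 3) • (1 : Hypercomplex t) := rfl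

theorem etaComb_commute (a b c : ℝ) (x y : Fin 4 → ℝ) :
    Commute (etaComb t a b c x) (etaComb t a b c y) := by
  simp only [etaComb_apply]
  generalize (Real.sign t / √|t|) • (b • J t + c • K t) - a • I t = d
  have h1 : ∀ (r : ℝ) (z : Hypercomplex t), Commute (r • (1 : Hypercomplex t)) z :=
    fun r z => (Commute.one_left z).smul_left r
  exact Commute.add_left
    (Commute.add_right (((Commute.refl d).smul_left _).smul_right _) (h1 _ _).symm) (h1 _ _)

theorem sum_etaComb {ι : Type*} (s : Finset ι) (a b c : ι → ℝ) (x : Fin 4 → ℝ) :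
    ∑ i ∈ s, etaComb t (a i) (b i) (c i) x =
      etaComb t (∑ i ∈ s, a i) (∑ i ∈ s, b i) (∑ i ∈ s, c i) x := by
  simp only [etaComb_apply, Finset.sum_add_distrib, ← Finset.smul_sum, ← Finset.sum_smul,
    Finset.sum_sub_distrib, ← Finset.sum_mul]

theorem eta2_eq : eta2 = fun x => (etaComb t 1 0 0 x : ℂ × ℂ) := by
  funext x
  change (x 1 • 1 - x 0 • I t : Hypercomplex t) = etaComb t 1 0 0 x
  rw [etaComb_apply]
  module

theorem eta3_eq : eta3 t = fun x => (etaComb t 0 1 0 x : ℂ × ℂ) := by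
  funext x
  change (x 2 • 1 + (Real.sign t * x 0 / √|t|) • J t : Hypercomplex t) = etaComb t 0 1 0 x
  rw [etaComb_apply]
  module

theorem eta4_eq : eta4 t = fun x => (etaComb t 0 0 1 x : ℂ × ℂ) := by
  funext x
  change (x 3 • 1 + (Real.sign t * x 0 / √|t|) • K t : Hypercomplex t) = etaComb t 0 0 1 x
  rw [etaComb_apply]
  module

/-- If every factor is a real combination of `η₂`, `η₃`, `η₄`, then so is the base of each power in
the polarization of the symmetrized product. -/
theorem symProd_eq_sum_pow (N : ℕ) (g : Fin N → (Fin 4 → ℝ) → ℂ × ℂ) (a b c : Fin N → ℝ)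
    (hg : ∀ i, g i = fun x => (etaComb t (a i) (b i) (c i) x : ℂ × ℂ)) :
    symProd t N g = fun x => (∑ T : Finset (Fin N), ((N.factorial : ℝ)⁻¹ * (-1) ^ T.card) •
      etaComb t (∑ i ∈ Tᶜ, a i) (∑ i ∈ Tᶜ, b i) (∑ i ∈ Tᶜ, c i) x ^ N : Hypercomplex t) := by
  funext x
  have h := (MultilinearMap.mkPiAlgebraFin ℝ N (Hypercomplex t)).sum_perm_eq_sum_diagonal
    (fun i => etaComb t (a i) (b i) (c i) x)
  simp only [MultilinearMap.mkPiAlgebraFin_apply, List.ofFn_const, List.prod_replicate,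
    sum_etaComb] at h
  have h' : symProd t N g x = ((N.factorial : ℝ)⁻¹ • ∑ σ : Equiv.Perm (Fin N),
      (List.ofFn fun i => etaComb t (a (σ i)) (b (σ i)) (c (σ i)) x).prod : Hypercomplex t) := by
    simp only [symProd, hg]
    rfl
  rw [h', h, Finset.smul_sum]
  refine Finset.sum_congr rfl fun T _ => ?_
  rw [mul_smul]
  congr 1
  rw [← Int.cast_smul_eq_zsmul ℝ]
  simp

/-- Partial derivative of a linear combination of powers of linear maps with commuting values. -/
theorem pd_sum_smul_mul_pow {ι : Type*} (s : Finset ι) (r : ι → ℝ) (d : ι → Hypercomplex t)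
    (L : ι → (Fin 4 → ℝ) →L[ℝ] Hypercomplex t) (hL : ∀ i x y, Commute (L i x) (L i y))
    (n : ℕ) (l : Fin 4) :
    pd l (fun x => (∑ i ∈ s, r i • (d i * L i x ^ n) : Hypercomplex t)) =
      fun x => (∑ i ∈ s, (r i * n) • (d i * L i (Pi.single l 1) * L i x ^ (n - 1)) :
        Hypercomplex t) := by
  funext x
  have h : HasFDerivAt (fun x => (∑ i ∈ s, r i • (d i * L i x ^ n) : Hypercomplex t))
      (∑ i ∈ s, r i • (mulCLM (d i)).comp ((n : ℝ) • (mulCLM.flip (L i x ^ (n - 1))).comp (L i)))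
      x := by
    refine HasFDerivAt.fun_sum fun i _ => HasFDerivAt.fun_const_smul ?_ (r i)
    exact (mulCLM (d i)).hasFDerivAt.comp x (hasFDerivAt_pow (L i) (hL i) n x)
  have h2 := congrArg (fun F => F (Pi.single l 1)) h.fderiv
  refine Eq.trans h2 ?_
  simp [mulCLM_apply, mul_smul, mul_assoc]
  rfl

theorem sign_div_sqrt_mul_self (ht : t ≠ 0) :
    (Real.sign t / √|t|) * (Real.sign t / √|t|) * t = Real.sign t := by
  have h : √|t| * √|t| = |t| := Real.mul_self_sqrt (abs_nonneg t)
  rw [div_mul_div_comm, h]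
  rcases lt_or_gt_of_ne ht with h | h
  · rw [Real.sign_of_neg h, abs_of_neg h]; field_simp
  · rw [Real.sign_of_pos h, abs_of_pos h]; field_simp

section Gradient

variable (a b c : ℝ)

theorem etaComb_single_zero : etaComb t a b c (Pi.single 0 1) =
    (Real.sign t / √|t|) • (b • J t + c • K t) - a • I t := by
  simp [etaComb_apply]

theorem etaComb_single_one : etaComb t a b c (Pi.single 1 1) = a • (1 : Hypercomplex t) := by
  simp [etaComb_apply]

theorem etaComb_single_two : etaComb t a b c (Pi.single 2 1) = b • (1 : Hypercomplex t) := by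
  simp [etaComb_apply]

theorem etaComb_single_three : etaComb t a b c (Pi.single 3 1) = c • (1 : Hypercomplex t) := by
  simp [etaComb_apply]

theorem etaComb_single_zero_mul_self (ht : t ≠ 0) :
    etaComb t a b c (Pi.single 0 1) * etaComb t a b c (Pi.single 0 1) =
      (Real.sign t * (b ^ 2 + c ^ 2) - a ^ 2) • (1 : Hypercomplex t) := by
  rw [etaComb_single_zero]
  have h := sign_div_sqrt_mul_self t ht
  generalize Real.sign t / √|t| = r at *
  rw [← h]
  simp only [mul_add, add_mul, mul_sub, sub_mul, smul_mul_assoc, mul_smul_comm, I_mul_I, I_mul_J,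
    I_mul_K, J_mul_I, J_mul_J, J_mul_K, K_mul_I, K_mul_J, K_mul_K]
  module

end Gradient

end Hypercomplex

open Hypercomplex in
/-- For `t ≠ 0` and `𝐧 = (n₁,n₂,n₃)` with `N = n₁+n₂+n₃ ≥ 1`, the symmetrized
product `η^𝐧` of `n₁` copies of `η₂`, `n₂` copies of `η₃` and `n₃` copies of
`η₄` is `t`-regular (both left and right) and `t`-harmonic on `ℝ⁴`. -/
theorem symProd_eta_t_regular_t_harmonic (t : ℝ) (ht : t ≠ 0)
    (n₁ n₂ n₃ N : ℕ) (hN : N = n₁ + n₂ + n₃) (hN1 : 1 ≤ N)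
    (g : Fin N → (Fin 4 → ℝ) → ℂ × ℂ)
    (hg : ∀ i : Fin N,
      g i = if (i : ℕ) < n₁ then eta2
            else if (i : ℕ) < n₁ + n₂ then eta3 t
            else eta4 t) :
    (∀ x, nablaL t (symProd t N g) x = 0) ∧
    (∀ x, nablaR t (symProd t N g) x = 0) ∧
    (∀ x, lapT t (symProd t N g) x = 0) := by
  obtain ⟨a, b, c, habc⟩ : ∃ a b c : Fin N → ℝ,
      ∀ i, g i = fun x => (etaComb t (a i) (b i) (c i) x : ℂ × ℂ) := by
    have : ∀ i, ∃ a b c : ℝ, g i = fun x => (etaComb t a b c x : ℂ × ℂ) := by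
      intro i
      rw [hg i]
      split_ifs
      · exact ⟨1, 0, 0, eta2_eq t⟩
      · exact ⟨0, 1, 0, eta3_eq t⟩
      · exact ⟨0, 0, 1, eta4_eq t⟩
    choose a b c h using this
    exact ⟨a, b, c, h⟩
  obtain ⟨r, A, B, C, hp⟩ : ∃ r A B C : Finset (Fin N) → ℝ, symProd t N g = fun x =>
      (∑ T, r T • ((1 : Hypercomplex t) * etaComb t (A T) (B T) (C T) x ^ N) :
        Hypercomplex t) :=
    ⟨_, _, _, _, by simpa only [one_mul] using symProd_eq_sum_pow t N g a b c habc⟩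
  have hL : ∀ (T : Finset (Fin N)) x y, Commute (etaComb t (A T) (B T) (C T) x)
      (etaComb t (A T) (B T) (C T) y) := fun T => etaComb_commute t _ _ _
  have hpd := fun l => pd_sum_smul_mul_pow t Finset.univ r (fun _ => 1)
    (fun T => etaComb t (A T) (B T) (C T)) hL N l
  rw [hp]
  refine ⟨fun x => ?_, fun x => ?_, fun x => ?_⟩
  · simp only [nablaL, hpd]
    change (_ + I t * _ - (Real.sign t / √|t|) • (J t * _) - (Real.sign t / √|t|) • (K t * _) :
      Hypercomplex t) = 0
    simp only [Finset.mul_sum, Finset.smul_sum, ← Finset.sum_add_distrib,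
      ← Finset.sum_sub_distrib]
    refine Finset.sum_eq_zero fun T _ => ?_
    simp only [etaComb_single_zero, etaComb_single_one, etaComb_single_two, etaComb_single_three,
      one_mul, smul_mul_assoc, mul_smul_comm, add_mul, sub_mul]
    module
  · simp only [nablaR, hpd]
    change (_ + _ * I t - (Real.sign t / √|t|) • (_ * J t) - (Real.sign t / √|t|) • (_ * K t) :
      Hypercomplex t) = 0
    simp only [Finset.sum_mul, Finset.smul_sum, ← Finset.sum_add_distrib,
      ← Finset.sum_sub_distrib]
    refine Finset.sum_eq_zero fun T _ => ?_
    have hc := (hL T (Pi.single 0 1) x).pow_right (N - 1)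
    rw [one_mul, hc.eq]
    simp only [etaComb_single_zero, etaComb_single_one, etaComb_single_two, etaComb_single_three,
      one_mul, smul_mul_assoc, mul_smul_comm, mul_add, mul_sub]
    module
  · have hpd2 := fun l => pd_sum_smul_mul_pow t Finset.univ (fun T => r T * N)
      (fun T => 1 * etaComb t (A T) (B T) (C T) (Pi.single l 1))
      (fun T => etaComb t (A T) (B T) (C T)) hL (N - 1) l
    simp only [lapT, hpd, hpd2]
    change (_ + _ - Real.sign t • _ - Real.sign t • _ : Hypercomplex t) = 0
    simp only [Finset.smul_sum, ← Finset.sum_add_distrib, ← Finset.sum_sub_distrib]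
    refine Finset.sum_eq_zero fun T _ => ?_
    simp only [one_mul, etaComb_single_zero_mul_self t _ _ _ ht, etaComb_single_one,
      etaComb_single_two, etaComb_single_three, smul_mul_assoc, mul_smul_comm]
    module
end

section
/- Let t = 0, let U ⊆ ℝ⁴ be an open set, and let f : ℝ⁴ → ℍ₀ be twice continuously differentiable on U. If f is left 0-regular on U, i.e. ∇₀ f = 0 on U, then f is 0-harmonic on U, i.e. ∂₁²f + ∂₂²f = 0 on U. -/
/-- The `0`-scaled hypercomplex multiplication on `ℂ × ℂ`:
`(a₁,b₁) ·₀ (a₂,b₂) = (a₁a₂, a₁b₂ + b₁·conj(a₂))`. -/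
noncomputable def hmul0 (h₁ h₂ : ℂ × ℂ) : ℂ × ℂ :=
  (h₁.1 * h₂.1, h₁.1 * h₂.2 + h₁.2 * (starRingEnd ℂ) h₂.1)

/-- The operator `∇₀ f = ∂₁f + i·∂₂f + j₀·∂₃f + k₀·∂₄f`, constants
multiplying from the left in `ℍ₀`. -/
noncomputable def nabla0 (f : (Fin 4 → ℝ) → ℂ × ℂ) : (Fin 4 → ℝ) → ℂ × ℂ :=
  fun x => pd 0 f x + hmul0 iH (pd 1 f x) + hmul0 jH (pd 2 f x)
    + hmul0 kH (pd 3 f x)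

/-- The operator `∇₀† f = ∂₁f − i·∂₂f − j₀·∂₃f − k₀·∂₄f`. -/
noncomputable def nabla0D (f : (Fin 4 → ℝ) → ℂ × ℂ) : (Fin 4 → ℝ) → ℂ × ℂ :=
  fun x => pd 0 f x - hmul0 iH (pd 1 f x) - hmul0 jH (pd 2 f x)
    - hmul0 kH (pd 3 f x)

/-- The right-hand operator `f∇₀ = ∂₁f + ∂₂f·i + ∂₃f·j₀ + ∂₄f·k₀`. -/
noncomputable def nabla0R (f : (Fin 4 → ℝ) → ℂ × ℂ) : (Fin 4 → ℝ) → ℂ × ℂ :=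
  fun x => pd 0 f x + hmul0 (pd 1 f x) iH + hmul0 (pd 2 f x) jH
    + hmul0 (pd 3 f x) kH

/-- The `0`-scaled Laplacian `Δ₀ f = ∂₁²f + ∂₂²f`. -/
noncomputable def lap0 (f : (Fin 4 → ℝ) → ℂ × ℂ) : (Fin 4 → ℝ) → ℂ × ℂ :=
  fun x => pd 0 (pd 0 f) x + pd 1 (pd 1 f) x

/-- The symbol of `∇₀`: the real linear map with `∇₀ f x = nablaSymbol (fderiv ℝ f x)`. -/
noncomputable def nablaSymbol : ((Fin 4 → ℝ) →L[ℝ] ℂ × ℂ) →ₗ[ℝ] ℂ × ℂ where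
  toFun T := T (Pi.single 0 1) + hmul0 iH (T (Pi.single 1 1)) + hmul0 jH (T (Pi.single 2 1))
    + hmul0 kH (T (Pi.single 3 1))
  map_add' S T := by
    ext1 <;> simp [hmul0, iH, jH, kH] <;> ring
  map_smul' c T := by
    ext1 <;> simp [hmul0, iH, jH, kH] <;> ring

/-- If `∇₀ f` vanishes near `x`, then so do the partial derivatives of `∇₀ f` at `x`, computed
from the second derivative of `f`. -/
theorem nablaSymbol_fderiv_fderiv {f : (Fin 4 → ℝ) → ℂ × ℂ} {x : Fin 4 → ℝ}
    (hf : DifferentiableAt ℝ (fderiv ℝ f) x) (h : ∀ᶠ y in nhds x, nabla0 f y = 0)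
    (v : Fin 4 → ℝ) : nablaSymbol (fderiv ℝ (fderiv ℝ f) x v) = 0 := by
  have h1 : HasFDerivAt (nabla0 f)
      (nablaSymbol.toContinuousLinearMap.comp (fderiv ℝ (fderiv ℝ f) x)) x :=
    nablaSymbol.toContinuousLinearMap.hasFDerivAt.comp x hf.hasFDerivAt
  have h2 : HasFDerivAt (nabla0 f) (0 : (Fin 4 → ℝ) →L[ℝ] ℂ × ℂ) x :=
    (hasFDerivAt_const (0 : ℂ × ℂ) x).congr_of_eventuallyEq h
  exact DFunLike.congr_fun (h1.unique h2) v

theorem pd_pd_apply {f : (Fin 4 → ℝ) → ℂ × ℂ} {x : Fin 4 → ℝ}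
    (hf : DifferentiableAt ℝ (fderiv ℝ f) x) (l m : Fin 4) :
    pd l (pd m f) x = fderiv ℝ (fderiv ℝ f) x (Pi.single l 1) (Pi.single m 1) := by
  have h := hf.hasFDerivAt.clm_apply (hasFDerivAt_const (Pi.single m (1 : ℝ) : Fin 4 → ℝ) x)
  change fderiv ℝ (fun y => fderiv ℝ f y (Pi.single m 1)) x (Pi.single l 1) = _
  rw [h.fderiv]
  simp

/-- For `U ⊆ ℝ⁴` open and `f` twice continuously differentiable on `U`:
if `f` is left `0`-regular on `U` (`∇₀ f = 0` on `U`), then `f` is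
`0`-harmonic on `U` (`∂₁²f + ∂₂²f = 0` on `U`). -/
theorem left_zero_regular_implies_zero_harmonic
    (U : Set (Fin 4 → ℝ)) (hU : IsOpen U)
    (f : (Fin 4 → ℝ) → ℂ × ℂ) (hf : ContDiffOn ℝ 2 f U)
    (hreg : ∀ x ∈ U, nabla0 f x = 0) :
    ∀ x ∈ U, lap0 f x = 0 := by
  intro x hx
  have hfx : ContDiffAt ℝ 2 f x := hf.contDiffAt (hU.mem_nhds hx)
  have hd : DifferentiableAt ℝ (fderiv ℝ f) x :=
    (hfx.fderiv_right (m := 1) (by norm_num)).differentiableAt (by norm_num)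
  have hsymm : IsSymmSndFDerivAt ℝ f x := hfx.isSymmSndFDerivAt (by simp)
  have hD := nablaSymbol_fderiv_fderiv hd (Filter.eventually_of_mem (hU.mem_nhds hx) hreg)
  rw [lap0, pd_pd_apply hd, pd_pd_apply hd]
  have h0 := hD (Pi.single 0 1)
  have h1 := hD (Pi.single 1 1)
  have h2 := hD (Pi.single 2 1)
  have h3 := hD (Pi.single 3 1)
  have s10 := hsymm.eq (Pi.single 1 1) (Pi.single 0 1)
  have s20 := hsymm.eq (Pi.single 2 1) (Pi.single 0 1)
  have s30 := hsymm.eq (Pi.single 3 1) (Pi.single 0 1)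
  have s21 := hsymm.eq (Pi.single 2 1) (Pi.single 1 1)
  have s31 := hsymm.eq (Pi.single 3 1) (Pi.single 1 1)
  simp only [nablaSymbol, LinearMap.coe_mk, AddHom.coe_mk, s10, s20, s30, s21, s31] at h0 h1 h2 h3
  simp only [hmul0, iH, jH, kH, Prod.ext_iff, Complex.ext_iff, Prod.fst_add, Prod.snd_add,
    Prod.fst_zero, Prod.snd_zero, Complex.add_re, Complex.add_im, Complex.mul_re, Complex.mul_im,
    Complex.I_re, Complex.I_im, Complex.conj_re, Complex.conj_im, Complex.zero_re,
    Complex.zero_im, Complex.one_re, Complex.one_im] at h0 h1 h2 h3 ⊢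
  obtain ⟨⟨h0a, h0b⟩, h0c, h0d⟩ := h0
  obtain ⟨⟨h1a, h1b⟩, h1c, h1d⟩ := h1
  obtain ⟨⟨h2a, h2b⟩, -⟩ := h2
  obtain ⟨⟨h3a, h3b⟩, -⟩ := h3
  refine ⟨⟨?_, ?_⟩, ?_, ?_⟩ <;> linarith
end
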